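/- In the setting of the estimate for D (X, Y real Hilbert spaces; A, V : X → Y bounded linear; ε > 0; η, η' > 0; ω = η/η'; μ_G, μ_F ∈ ℝ; G γ_G-strongly convex with γ_G ≥ (ε/(2ω))‖A − V‖ + μ_G; F* γ_F-strongly convex; points x⁰, x¹, x̂ ∈ X, y⁰, y¹, ŷ ∈ Y; g a subgradient of G at x¹, f a subgradient of F* at y¹, −V*ŷ a subgradient of G at x̂, A x̂ a subgradient of F* at ŷ; D defined as D = η⟨g + V*y¹, x¹ − x̂⟩ + η'⟨f − A(x¹ + ω(x¹ − x⁰)) − ω V(x⁰ − x¹), y¹ − ŷ⟩ + (η' − η)⟨V(x¹ − x̂), y¹ − ŷ⟩ − η μ_G‖x¹ − x̂‖² − η' μ_F‖y¹ − ŷ‖²), assume additionally that φ, ψ > 0 and 0 < δ ≤ κ < 1 satisfy φ ≥ ε η ‖A − V‖/δ and ψ ≥ η²‖V‖²/(φ(1 − κ)), and let Δ ∈ ℝ satisfy ½[(δφ − εη‖A − V‖)‖x¹ − x⁰‖² + ψ‖y¹ − y⁰‖² − (η²/(φ(1 − κ)))‖V*(y¹ − y⁰)‖²] + η'(γ_F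 − μ_F − ((1 + ω)/(2ε))‖A − V‖)‖y¹ − ŷ‖² ≥ −Δ. Then −Δ ≤ ½[φ‖x¹ − x⁰‖² − 2η⟨V(x¹ − x⁰), y¹ − y⁰⟩ + ψ‖y¹ − y⁰‖²] + D. -/

import Mathlib

open scoped RealInnerProductSpace

/-- `g` is a subgradient of `f : E → ℝ` at `x`. -/
def HasSubgradientAt {E : Type*} [NormedAddCommGroup E] [InnerProductSpace ℝ E]
    (f : E → ℝ) (g x : E) : Prop :=
  ∀ u, f x + ⟪g, u - x⟫ ≤ f u

/-- `f` is `γ`-strongly convex: `u ↦ f u - γ/2 * ‖u‖²` is convex. -/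
def StronglyConvexWith {E : Type*} [NormedAddCommGroup E] [InnerProductSpace ℝ E]
    (γ : ℝ) (f : E → ℝ) : Prop :=
  ConvexOn ℝ Set.univ (fun u => f u - γ / 2 * ‖u‖ ^ 2)

theorem strong_subgrad {E : Type*} [NormedAddCommGroup E] [InnerProductSpace ℝ E]
    {γ : ℝ} (hγ : 0 < γ) {F : E → ℝ} (hF : StronglyConvexWith γ F) {g x : E}
    (hg : HasSubgradientAt F g x) (u : E) :
    F x + ⟪g, u - x⟫ + γ / 2 * ‖u - x‖ ^ 2 ≤ F u := by
  have key : ∀ t : ℝ, 0 < t → t < 1 →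
      ⟪g, u - x⟫ ≤ F u - F x - γ / 2 * (1 - t) * ‖u - x‖ ^ 2 := by
    intro t ht0 ht1
    have h1 := hF.2 (Set.mem_univ x) (Set.mem_univ u) (sub_nonneg.2 ht1.le) ht0.le
      (by ring)
    have h2 := hg ((1 - t) • x + t • u)
    have e1 : (1 - t) • x + t • u - x = t • (u - x) := by module
    rw [e1, real_inner_smul_right] at h2
    have e2 : ‖(1 - t) • x + t • u‖ ^ 2
        = (1 - t) * ‖x‖ ^ 2 + t * ‖u‖ ^ 2 - t * (1 - t) * ‖u - x‖ ^ 2 := by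
      rw [norm_add_sq_real, norm_sub_sq_real, norm_smul, norm_smul, mul_pow, mul_pow,
        real_inner_smul_left, real_inner_smul_right, real_inner_comm u x]
      simp only [Real.norm_eq_abs, sq_abs]
      ring
    simp only [smul_eq_mul] at h1
    rw [e2] at h1
    refine le_of_mul_le_mul_left ?_ ht0
    linarith
  by_contra! hcon
  set K := γ / 2 * ‖u - x‖ ^ 2 with hK
  have hK0 : 0 ≤ K := by positivity
  set s := F x + ⟪g, u - x⟫ + K - F u with hs
  have hs0 : 0 < s := by linarith
  have hd : 0 < s + K + 1 := by linarith
  have h := key (s / (s + K + 1)) (by positivity) (by rw [div_lt_one hd]; linarith)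
  have h3 : s ≤ s / (s + K + 1) * K := by
    have : γ / 2 * (1 - s / (s + K + 1)) * ‖u - x‖ ^ 2 = K - s / (s + K + 1) * K := by
      rw [hK]; ring
    linarith
  rw [div_mul_eq_mul_div, le_div_iff₀ hd] at h3
  nlinarith

theorem strong_mono {E : Type*} [NormedAddCommGroup E] [InnerProductSpace ℝ E]
    {γ : ℝ} (hγ : 0 < γ) {F : E → ℝ} (hF : StronglyConvexWith γ F) {g x g' x' : E}
    (hg : HasSubgradientAt F g x) (hg' : HasSubgradientAt F g' x') :
    γ * ‖x - x'‖ ^ 2 ≤ ⟪g, x - x'⟫ - ⟪g', x - x'⟫ := by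
  have h1 := strong_subgrad hγ hF hg x'
  have h2 := strong_subgrad hγ hF hg' x
  rw [norm_sub_rev x' x, ← neg_sub x x', inner_neg_right] at h1
  linarith

theorem op_young {X Y : Type*}
    [NormedAddCommGroup X] [InnerProductSpace ℝ X]
    [NormedAddCommGroup Y] [InnerProductSpace ℝ Y]
    (B : X →L[ℝ] Y) {ε : ℝ} (hε : 0 < ε) (a : X) (b : Y) :
    ⟪B a, b⟫ ≤ ε / 2 * ‖B‖ * ‖a‖ ^ 2 + 1 / (2 * ε) * ‖B‖ * ‖b‖ ^ 2 := by
  have h1 : ⟪B a, b⟫ ≤ ‖B‖ * (‖a‖ * ‖b‖) := by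
    refine (real_inner_le_norm _ _).trans ?_
    rw [← mul_assoc]
    exact mul_le_mul_of_nonneg_right (B.le_opNorm a) (norm_nonneg _)
  have h2 : ‖a‖ * ‖b‖ ≤ ε / 2 * ‖a‖ ^ 2 + 1 / (2 * ε) * ‖b‖ ^ 2 := by
    have : ε / 2 * ‖a‖ ^ 2 + 1 / (2 * ε) * ‖b‖ ^ 2 - ‖a‖ * ‖b‖
        = 1 / (2 * ε) * (ε * ‖a‖ - ‖b‖) ^ 2 := by field_simp; ring
    have h : 0 ≤ 1 / (2 * ε) * (ε * ‖a‖ - ‖b‖) ^ 2 := by positivity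
    linarith
  have h3 := mul_le_mul_of_nonneg_left h2 (norm_nonneg B)
  linarith

theorem statement6 {X Y : Type*}
    [NormedAddCommGroup X] [InnerProductSpace ℝ X] [CompleteSpace X]
    [NormedAddCommGroup Y] [InnerProductSpace ℝ Y] [CompleteSpace Y]
    (A V : X →L[ℝ] Y)
    (ε η η' ω μG μF γG γF : ℝ)
    (hε : 0 < ε) (hη : 0 < η) (hη' : 0 < η') (hω : ω = η / η')
    (hγG : 0 < γG) (hγF : 0 < γF)
    (hγGbound : γG ≥ ε / (2 * ω) * ‖A - V‖ + μG)
    (G : X → ℝ) (Fstar : Y → ℝ)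
    (hG : StronglyConvexWith γG G)
    (hFstar : StronglyConvexWith γF Fstar)
    (x0 x1 xh : X) (y0 y1 yh : Y) (g : X) (f : Y)
    (hg : HasSubgradientAt G g x1)
    (hf : HasSubgradientAt Fstar f y1)
    (hxh : HasSubgradientAt G (-(ContinuousLinearMap.adjoint V yh)) xh)
    (hyh : HasSubgradientAt Fstar (A xh) yh)
    (D : ℝ)
    (hD : D = η * ⟪g + ContinuousLinearMap.adjoint V y1, x1 - xh⟫
        + η' * ⟪f - A (x1 + ω • (x1 - x0)) - ω • V (x0 - x1), y1 - yh⟫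
        + (η' - η) * ⟪V (x1 - xh), y1 - yh⟫
        - η * μG * ‖x1 - xh‖ ^ 2 - η' * μF * ‖y1 - yh‖ ^ 2)
    (φ ψ δ κ : ℝ) (hφ : 0 < φ) (hψ : 0 < ψ)
    (hδ : 0 < δ) (hδκ : δ ≤ κ) (hκ : κ < 1)
    (hφbound : φ ≥ ε * η * ‖A - V‖ / δ)
    (hψbound : ψ ≥ η ^ 2 * ‖V‖ ^ 2 / (φ * (1 - κ)))
    (Δ : ℝ)
    (hΔ : (1 / 2) * ((δ * φ - ε * η * ‖A - V‖) * ‖x1 - x0‖ ^ 2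
          + ψ * ‖y1 - y0‖ ^ 2
          - η ^ 2 / (φ * (1 - κ)) * ‖ContinuousLinearMap.adjoint V (y1 - y0)‖ ^ 2)
        + η' * (γF - μF - (1 + ω) / (2 * ε) * ‖A - V‖) * ‖y1 - yh‖ ^ 2 ≥ -Δ) :
    -Δ ≤ (1 / 2) * (φ * ‖x1 - x0‖ ^ 2 - 2 * η * ⟪V (x1 - x0), y1 - y0⟫
        + ψ * ‖y1 - y0‖ ^ 2) + D := by
  have hG1 := strong_mono hγG hG hg hxh
  have hF1 := strong_mono hγF hFstar hf hyh
  rw [inner_neg_left, ContinuousLinearMap.adjoint_inner_left] at hG1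
  have hY1 := op_young (A - V) hε (x1 - xh) (y1 - yh)
  have hY2 := op_young (A - V) hε (x1 - x0) (y1 - yh)
  have hωη : η' * ω = η := by rw [hω]; field_simp
  have hω0 : 0 < ω := by rw [hω]; positivity
  have hDeq : D = η * (⟪g, x1 - xh⟫ + ⟪yh, V (x1 - xh)⟫)
      + η' * (⟪f, y1 - yh⟫ - ⟪A xh, y1 - yh⟫)
      - η' * ⟪(A - V) (x1 - xh), y1 - yh⟫ - η * ⟪(A - V) (x1 - x0), y1 - yh⟫
      - η * μG * ‖x1 - xh‖ ^ 2 - η' * μF * ‖y1 - yh‖ ^ 2 := by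
    rw [hD, ← hωη]
    have e : ⟪V (x1 - xh), y1 - yh⟫ = ⟪y1, V (x1 - xh)⟫ - ⟪yh, V (x1 - xh)⟫ := by
      rw [real_inner_comm, inner_sub_left]
    rw [inner_add_left, ContinuousLinearMap.adjoint_inner_left]
    have e' : ⟪y1, V (x1 - xh)⟫ = ⟪V (x1 - xh), y1 - yh⟫ + ⟪yh, V (x1 - xh)⟫ := by
      linarith
    rw [e']
    simp only [ContinuousLinearMap.sub_apply, map_sub, map_add, map_smul, inner_sub_left,
      inner_add_left, real_inner_smul_left]
    ring
  have hG2 : η' * (ε / 2 * ‖A - V‖ * ‖x1 - xh‖ ^ 2) ≤ η * (γG - μG) * ‖x1 - xh‖ ^ 2 := by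
    have h : η * (ε / (2 * ω) * ‖A - V‖) ≤ η * (γG - μG) :=
      mul_le_mul_of_nonneg_left (by linarith) hη.le
    have h' : η * (ε / (2 * ω) * ‖A - V‖) = η' * (ε / 2 * ‖A - V‖) := by
      rw [← hωη]; field_simp
    rw [h'] at h
    have := mul_le_mul_of_nonneg_right h (sq_nonneg ‖x1 - xh‖)
    linarith
  have hV : η * ⟪V (x1 - x0), y1 - y0⟫ ≤ (1 / 2) * ((1 - δ) * φ * ‖x1 - x0‖ ^ 2
      + η ^ 2 / (φ * (1 - κ)) * ‖ContinuousLinearMap.adjoint V (y1 - y0)‖ ^ 2) := by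
    rw [← ContinuousLinearMap.adjoint_inner_right]
    have h1 := real_inner_le_norm (x1 - x0) (ContinuousLinearMap.adjoint V (y1 - y0))
    set p := ‖x1 - x0‖
    set q := ‖ContinuousLinearMap.adjoint V (y1 - y0)‖
    have hc : 0 < φ * (1 - κ) := mul_pos hφ (by linarith)
    have h2 : η * (p * q) ≤ (1 / 2) * (φ * (1 - κ) * p ^ 2 + η ^ 2 / (φ * (1 - κ)) * q ^ 2) := by
      generalize φ * (1 - κ) = c at hc
      have : (1 / 2) * (c * p ^ 2 + η ^ 2 / c * q ^ 2) - η * (p * q)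
        = 1 / (2 * c) * (c * p - η * q) ^ 2 := by field_simp; ring
      have h : 0 ≤ 1 / (2 * c) * (c * p - η * q) ^ 2 := by positivity
      linarith
    have h3 : φ * (1 - κ) * p ^ 2 ≤ (1 - δ) * φ * p ^ 2 :=
      mul_le_mul_of_nonneg_right (by nlinarith) (sq_nonneg p)
    have h4 := mul_le_mul_of_nonneg_left h1 hη.le
    linarith
  have a1 := mul_le_mul_of_nonneg_left hG1 hη.le
  have a2 := mul_le_mul_of_nonneg_left hF1 hη'.le
  have a3 := mul_le_mul_of_nonneg_left hY1 hη'.le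
  have a4 := mul_le_mul_of_nonneg_left hY2 hη.le
  have e5 : η' * (γF - μF - (1 + ω) / (2 * ε) * ‖A - V‖) * ‖y1 - yh‖ ^ 2
      = η' * (γF - μF) * ‖y1 - yh‖ ^ 2
        - (η' + η) * (1 / (2 * ε) * ‖A - V‖ * ‖y1 - yh‖ ^ 2) := by
    rw [← hωη]; ring
  rw [e5] at hΔ
  rw [hDeq]
  linarith
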